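/- Assume κ > 0 with 1/κ ∉ ℤ, let l be a positive integer, a, b ∈ {0,…,l}, and let m₁, m₂, z, μ be complex numbers with Re m₁ < 0, Re m₂ < 0, Re z = 0 and 0 < Im μ < 2π. Let ε be a real number with 0 < ε < min(−Re m₁, −Re m₂) such that ε + Re m₁ ∉ κℤ and ε + Re m₂ ∉ κℤ. Then, setting t_u = ε + i y_u for u = 1,…,l, the integrand Φ_l(t,z,μ;m₁,m₂) · w_{l−a,a}(t,z;m₁,m₂) · W_{l−b,b}(t,z;m₁,m₂) is well defined (all denominators are nonzero and no Gamma factor has a pole) for every (y₁,…,y_l) ∈ ℝ^l, and it is absolutely integrable as a function of (y₁,…,y_l) over ℝ^l. (This is the convergence of the l-dimensional Barnes type q-hypergeometric integral I_{a,b}(z,μ;m₁,m₂,l₁,l₂) over the contour Re t_u = ε.) -/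

import Mathlib

open Complex MeasureTheory Real Finset

/-- Symmetrization: `SymSum f(t₁,…,t_l) = Σ_{σ ∈ S_l} f(t_{σ(1)},…,t_{σ(l)})`. -/
noncomputable def SymSum {l : ℕ} (f : (Fin l → ℂ) → ℂ) (t : Fin l → ℂ) : ℂ :=
  ∑ σ : Equiv.Perm (Fin l), f (t ∘ σ)

/-- The q-master function `Φ_l(t,z,μ;m₁,m₂)`. -/
noncomputable def qMaster (κ : ℂ) {l : ℕ} (t : Fin l → ℂ) (z μ m₁ m₂ : ℂ) : ℂ :=
  Complex.exp (μ * (∑ u, t u) / κ) *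
  (∏ u, (Complex.Gamma (t u / κ) * Complex.Gamma ((t u - z) / κ)) /
      (Complex.Gamma ((t u + m₁) / κ) * Complex.Gamma ((t u - z + m₂) / κ))) *
  ∏ u, ∏ v ∈ Finset.Ioi u,
    Complex.Gamma ((t u - t v + 1) / κ) / Complex.Gamma ((t u - t v - 1) / κ)

/-- The rational weight function `w_{l−a,a}(t,z;m₁,m₂)` (indices `u = l−a+1,…,l` of the paper
correspond to the 0-based indices `u` with `l − a ≤ u`). -/
noncomputable def ratWeight {l : ℕ} (a : ℕ) (t : Fin l → ℂ) (z m₁ m₂ : ℂ) : ℂ :=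
  (∏ u, ∏ v ∈ Finset.Ioi u, (t u - t v) / (t u - t v - 1)) *
  (∏ u, (t u + m₁)⁻¹) *
  SymSum (fun s =>
    (∏ u ∈ Finset.univ.filter (fun u : Fin l => l - a ≤ (u : ℕ)), s u / (s u - z + m₂)) *
    ∏ u, ∏ v ∈ Finset.Ioi u, (s u - s v - 1) / (s u - s v)) t

/-- The trigonometric weight function `W_{l−b,b}(t,z;m₁,m₂)`. -/
noncomputable def trigWeight (κ : ℂ) {l : ℕ} (b : ℕ) (t : Fin l → ℂ) (z m₁ m₂ : ℂ) : ℂ :=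
  (∏ u, ∏ v ∈ Finset.Ioi u,
      Complex.sin ((π : ℂ) * (t u - t v) / κ) / Complex.sin ((π : ℂ) * (t u - t v - 1) / κ)) *
  (∏ u, Complex.exp (-(π : ℂ) * Complex.I * t u / κ) /
      Complex.sin ((π : ℂ) * (t u + m₁) / κ)) *
  SymSum (fun s =>
    (∏ u ∈ Finset.univ.filter (fun u : Fin l => l - b ≤ (u : ℕ)),
        Complex.exp ((π : ℂ) * Complex.I * z / κ) * Complex.sin ((π : ℂ) * s u / κ) /
          Complex.sin ((π : ℂ) * (s u - z + m₂) / κ)) *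
    ∏ u, ∏ v ∈ Finset.Ioi u,
      Complex.sin ((π : ℂ) * (s u - s v - 1) / κ) / Complex.sin ((π : ℂ) * (s u - s v) / κ)) t

lemma measurable_complexGamma : Measurable Complex.Gamma := by
  have h := Complex.differentiable_one_div_Gamma.continuous.measurable.inv
  simpa [Pi.inv_def] using h

lemma Complex.norm_sin_le_exp_abs_im (w : ℂ) : ‖Complex.sin w‖ ≤ Real.exp |w.im| := by
  have h1 : ‖Complex.exp (-w * Complex.I)‖ ≤ Real.exp |w.im| := by
    rw [Complex.norm_exp]
    exact Real.exp_le_exp.2 (by simpa using le_abs_self w.im)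
  have h2 : ‖Complex.exp (w * Complex.I)‖ ≤ Real.exp |w.im| := by
    rw [Complex.norm_exp]
    exact Real.exp_le_exp.2 (by simpa using neg_le_abs w.im)
  have h3 := norm_sub_le (Complex.exp (-w * Complex.I)) (Complex.exp (w * Complex.I))
  rw [Complex.sin, norm_div, norm_mul, Complex.norm_I, mul_one, Complex.norm_ofNat]
  linarith

lemma Complex.abs_sin_re_mul_exp_abs_im_le (w : ℂ) :
    |Real.sin w.re| * Real.exp |w.im| / 2 ≤ ‖Complex.sin w‖ := by
  have h : (Complex.sin w).re = Real.sin w.re * Real.cosh w.im := by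
    rw [Complex.sin_eq, ← Complex.ofReal_sin, ← Complex.ofReal_cos, ← Complex.ofReal_sinh,
      ← Complex.ofReal_cosh]
    simp [-Complex.ofReal_sin, -Complex.ofReal_cos, -Complex.ofReal_sinh, -Complex.ofReal_cosh]
  have h1 := Complex.abs_re_le_norm (Complex.sin w)
  rw [h, abs_mul, abs_of_pos (Real.cosh_pos _)] at h1
  have h2 : Real.exp |w.im| / 2 ≤ Real.cosh w.im := by
    rw [← Real.cosh_abs, Real.cosh_eq]
    have := Real.exp_pos (-|w.im|)
    linarith
  calc _ = |Real.sin w.re| * (Real.exp |w.im| / 2) := by ring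
    _ ≤ _ := mul_le_mul_of_nonneg_left h2 (abs_nonneg _)
    _ ≤ _ := h1

lemma Real.sin_pi_mul_ne_zero {x : ℝ} (hx : ∀ n : ℤ, x ≠ n) : Real.sin (π * x) ≠ 0 := by
  intro h
  obtain ⟨n, hn⟩ := Real.sin_eq_zero_iff.1 h
  exact hx n (mul_left_cancel₀ Real.pi_ne_zero (by linarith))

lemma Complex.exp_le_const_mul_norm_sin {x : ℝ} (hx : ∀ n : ℤ, x ≠ n) :
    ∃ c > 0, ∀ w : ℂ, w.re = x → c * Real.exp (π * |w.im|) ≤ ‖Complex.sin (π * w)‖ := by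
  refine ⟨|Real.sin (π * x)| / 2, by have := Real.sin_pi_mul_ne_zero hx; positivity,
    fun w hw => ?_⟩
  have h := Complex.abs_sin_re_mul_exp_abs_im_le (π * w)
  simp only [Complex.re_ofReal_mul, Complex.im_ofReal_mul, abs_mul, abs_of_pos Real.pi_pos, hw] at h
  linarith

lemma Complex.norm_sin_pi_mul_le (w : ℂ) : ‖Complex.sin (π * w)‖ ≤ Real.exp (π * |w.im|) := by
  simpa [abs_mul, abs_of_pos Real.pi_pos] using Complex.norm_sin_le_exp_abs_im (π * w)

/-- Exponential decay of `Γ` along the vertical line `Re w = 1 / 2`. -/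
lemma Complex.norm_Gamma_le_of_re_eq_half {w : ℂ} (hw : w.re = 1 / 2) :
    ‖Complex.Gamma w‖ ≤ √(2 * π) * Real.exp (-(π * |w.im| / 2)) := by
  have hconj : 1 - w = (starRingEnd ℂ) w := by
    apply Complex.ext <;> simp [hw]; norm_num
  have h := congrArg norm (Complex.Gamma_mul_Gamma_one_sub w)
  rw [hconj, Complex.Gamma_conj, norm_mul, Complex.norm_conj, norm_div, Complex.norm_real,
    Real.norm_of_nonneg Real.pi_pos.le] at h
  have hs := Complex.abs_sin_re_mul_exp_abs_im_le (π * w)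
  simp only [Complex.re_ofReal_mul, Complex.im_ofReal_mul, abs_mul, abs_of_pos Real.pi_pos, hw,
    mul_one_div, Real.sin_pi_div_two, abs_one, one_mul] at hs
  have hE := Real.exp_pos (π * |w.im|)
  have h2 : ‖Complex.Gamma w‖ ^ 2 ≤ (√(2 * π) * Real.exp (-(π * |w.im| / 2))) ^ 2 := by
    rw [sq, h, mul_pow, Real.sq_sqrt (by positivity), ← Real.exp_nat_mul]
    calc π / ‖Complex.sin (π * w)‖ ≤ π / (Real.exp (π * |w.im|) / 2) :=
          div_le_div_of_nonneg_left Real.pi_pos.le (by positivity) hs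
      _ = 2 * π * Real.exp (-(π * |w.im|)) := by
          rw [Real.exp_neg]; field_simp
      _ = _ := by congr 2; push_cast; ring
  exact le_of_sq_le_sq h2 (by positivity)

lemma Complex.norm_Gamma_le_of_re_eq_nat_add_half (n : ℕ) :
    ∃ C, 0 ≤ C ∧ ∀ w : ℂ, w.re = n + 1 / 2 →
      ‖Complex.Gamma w‖ ≤ C * (1 + |w.im|) ^ n * Real.exp (-(π * |w.im| / 2)) := by
  induction n with
  | zero =>
    exact ⟨√(2 * π), by positivity, fun w hw => by
      simpa using Complex.norm_Gamma_le_of_re_eq_half (by simpa using hw)⟩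
  | succ n ih =>
    obtain ⟨C, hC, h⟩ := ih
    refine ⟨C * (n + 1), by positivity, fun w hw => ?_⟩
    have hre : (w - 1).re = n + 1 / 2 := by
      rw [Complex.sub_re, hw, Complex.one_re]; push_cast; ring
    have him : (w - 1).im = w.im := by simp
    have h0 : w - 1 ≠ 0 := by
      intro h0
      rw [h0, Complex.zero_re] at hre
      have : (0 : ℝ) ≤ n := n.cast_nonneg
      linarith
    have h1 := h (w - 1) hre
    have h2 : ‖w - 1‖ ≤ (n + 1) * (1 + |w.im|) := by
      have := Complex.norm_le_abs_re_add_abs_im (w - 1)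
      rw [hre, him, abs_of_nonneg (by positivity)] at this
      nlinarith [abs_nonneg w.im, (n.cast_nonneg : (0 : ℝ) ≤ n)]
    have h3 := Complex.Gamma_add_one (w - 1) h0
    rw [sub_add_cancel] at h3
    rw [h3, norm_mul]
    rw [him] at h1
    calc _ ≤ ((n + 1) * (1 + |w.im|)) * (C * (1 + |w.im|) ^ n * Real.exp (-(π * |w.im| / 2))) := by
          gcongr
      _ = _ := by ring

/-- On the vertical line `Re u = x`, the beta integral is bounded. -/
lemma Complex.norm_betaIntegral_le {x c : ℝ} :
    ∃ B, 0 ≤ B ∧ ∀ u : ℂ, u.re = x → ‖Complex.betaIntegral u c‖ ≤ B := by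
  refine ⟨∫ t : ℝ in 0..1, ‖(t : ℂ) ^ ((x : ℂ) - 1) * (1 - (t : ℂ)) ^ ((c : ℂ) - 1)‖,
    intervalIntegral.integral_nonneg zero_le_one fun _ _ => norm_nonneg _, fun u hu => ?_⟩
  refine (intervalIntegral.norm_integral_le_integral_norm zero_le_one).trans_eq ?_
  refine intervalIntegral.integral_congr_ae (Filter.Eventually.of_forall fun t ht => ?_)
  rw [Set.uIoc_of_le zero_le_one] at ht
  simp only [norm_mul]
  rw [Complex.norm_cpow_eq_rpow_re_of_pos ht.1, Complex.norm_cpow_eq_rpow_re_of_pos ht.1]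
  simp [hu]

/-- Exponential decay of `Γ`, up to a polynomial factor, along the vertical line `Re w = x`. -/
lemma Complex.norm_Gamma_le_of_re_eq {x : ℝ} (hx : 0 < x) :
    ∃ C, 0 ≤ C ∧ ∃ n : ℕ, ∀ w : ℂ, w.re = x →
      ‖Complex.Gamma w‖ ≤ C * (1 + |w.im|) ^ n * Real.exp (-(π * |w.im| / 2)) := by
  obtain ⟨n, hn⟩ := exists_nat_gt x
  obtain ⟨C, hC, h⟩ := Complex.norm_Gamma_le_of_re_eq_nat_add_half n
  set c : ℝ := n + 1 / 2 - x with hc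
  have hc0 : 0 < c := by rw [hc]; linarith
  obtain ⟨B, hB, hb⟩ := @Complex.norm_betaIntegral_le x c
  have hG : 0 < Real.Gamma c := Real.Gamma_pos_of_pos hc0
  refine ⟨C * B / Real.Gamma c, by positivity, n, fun w hw => ?_⟩
  have h1 := congrArg norm (Complex.Gamma_mul_Gamma_eq_betaIntegral (s := w) (t := c)
    (by rw [hw]; exact hx) (by simpa using hc0))
  rw [norm_mul, norm_mul, Complex.Gamma_ofReal, Complex.norm_real, Real.norm_of_nonneg hG.le] at h1
  have h2 := h (w + c) (by simp [hw, hc])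
  simp only [Complex.add_im, Complex.ofReal_im, add_zero] at h2
  have h3 := mul_le_mul h2 (hb w hw) (norm_nonneg _) (by positivity)
  rw [← h1] at h3
  calc _ ≤ C * (1 + |w.im|) ^ n * Real.exp (-(π * |w.im| / 2)) * B / Real.Gamma c :=
        (le_div_iff₀ hG).2 h3
    _ = _ := by ring

lemma Complex.inv_norm_Gamma_le_of_re_eq {x : ℝ} (hx : x < 1) :
    ∃ C, 0 ≤ C ∧ ∃ n : ℕ, ∀ w : ℂ, w.re = x →
      ‖Complex.Gamma w‖⁻¹ ≤ C * (1 + |w.im|) ^ n * Real.exp (π * |w.im| / 2) := by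
  obtain ⟨C, hC, n, h⟩ := Complex.norm_Gamma_le_of_re_eq (sub_pos.2 hx)
  refine ⟨C / π, by positivity, n, fun w hw => ?_⟩
  have hre : (1 - w).re = 1 - x := by simp [hw]
  have h0 : Complex.Gamma (1 - w) ≠ 0 :=
    Complex.Gamma_ne_zero_of_re_pos (by rw [hre]; linarith)
  have h1 : Complex.Gamma w = π / Complex.sin (π * w) / Complex.Gamma (1 - w) := by
    rw [eq_div_iff h0, Complex.Gamma_mul_Gamma_one_sub]
  have h2 := h (1 - w) hre
  have him : |(1 - w).im| = |w.im| := by simp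
  rw [him] at h2
  have h3 := Complex.norm_sin_pi_mul_le w
  rw [h1, norm_div, norm_div, Complex.norm_real, Real.norm_of_nonneg Real.pi_pos.le, inv_div,
    div_div_eq_mul_div]
  calc _ ≤ (C * (1 + |w.im|) ^ n * Real.exp (-(π * |w.im| / 2))) * Real.exp (π * |w.im|) / π := by
        gcongr
    _ = C / π * (1 + |w.im|) ^ n * (Real.exp (-(π * |w.im| / 2)) * Real.exp (π * |w.im|)) := by ring
    _ = _ := by rw [← Real.exp_add]; congr 2; ring

/-- Quotients of Gamma functions grow at most polynomially along vertical lines. -/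
lemma Complex.norm_Gamma_div_Gamma_le {x x' : ℝ} (hx : 0 < x) (hx' : x' < 1) (s : ℝ) :
    ∃ C, 0 ≤ C ∧ ∃ n : ℕ, ∀ w w' : ℂ, w.re = x → w'.re = x' → w'.im = w.im + s →
      ‖Complex.Gamma w / Complex.Gamma w'‖ ≤ C * (1 + |w.im|) ^ n := by
  obtain ⟨C, hC, n, h⟩ := Complex.norm_Gamma_le_of_re_eq hx
  obtain ⟨C', hC', n', h'⟩ := Complex.inv_norm_Gamma_le_of_re_eq hx'
  refine ⟨C * (C' * (1 + |s|) ^ n' * Real.exp (π * |s| / 2)), by positivity, n + n',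
    fun w w' hw hw' hs => ?_⟩
  have h1 : |w'.im| ≤ |w.im| + |s| := hs ▸ abs_add_le _ _
  have h2 : 1 + |w'.im| ≤ (1 + |s|) * (1 + |w.im|) := by
    nlinarith [abs_nonneg s, abs_nonneg w.im]
  rw [norm_div, div_eq_mul_inv]
  calc _ ≤ (C * (1 + |w.im|) ^ n * Real.exp (-(π * |w.im| / 2))) *
        (C' * (1 + |w'.im|) ^ n' * Real.exp (π * |w'.im| / 2)) := by
        gcongr
        exacts [h w hw, h' w' hw']
    _ ≤ (C * (1 + |w.im|) ^ n * Real.exp (-(π * |w.im| / 2))) *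
        (C' * ((1 + |s|) * (1 + |w.im|)) ^ n' * Real.exp (π * (|w.im| + |s|) / 2)) := by
        gcongr
    _ = C * (C' * (1 + |s|) ^ n') * (1 + |w.im|) ^ (n + n') *
        (Real.exp (-(π * |w.im| / 2)) * Real.exp (π * (|w.im| + |s|) / 2)) := by
        rw [mul_pow, pow_add]; ring
    _ = _ := by
        rw [← Real.exp_add]
        have : -(π * |w.im| / 2) + π * (|w.im| + |s|) / 2 = π * |s| / 2 := by ring
        rw [this]; ring

lemma integrable_exp_neg_mul_abs {c : ℝ} (hc : 0 < c) :
    Integrable (fun y : ℝ => Real.exp (-c * |y|)) := by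
  rw [← integrableOn_univ, ← Set.Iic_union_Ioi (a := (0 : ℝ))]
  refine IntegrableOn.union ?_ ?_
  · refine (integrableOn_exp_mul_Iic hc 0).congr_fun (fun y hy => ?_) measurableSet_Iic
    simp only [abs_of_nonpos (Set.mem_Iic.1 hy)]; ring_nf
  · refine (integrableOn_exp_mul_Ioi (neg_lt_zero.2 hc) 0).congr_fun (fun y hy => ?_)
      measurableSet_Ioi
    simp only [abs_of_pos (Set.mem_Ioi.1 hy)]

lemma integrable_one_add_abs_pow_mul_exp {c : ℝ} (hc : 0 < c) (n : ℕ) :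
    Integrable (fun y : ℝ => (1 + |y|) ^ n * Real.exp (-c * |y|)) := by
  refine Integrable.mono' ((integrable_exp_neg_mul_abs (half_pos hc)).const_mul
    (n.factorial * (2 / c) ^ n * Real.exp (c / 2))) (by fun_prop)
    (Filter.Eventually.of_forall fun y => ?_)
  rw [Real.norm_of_nonneg (by positivity)]
  have h := Real.pow_div_factorial_le_exp (c / 2 * (1 + |y|)) (by positivity) n
  rw [div_le_iff₀ (by positivity), mul_pow, div_pow] at h
  have h' : (1 + |y|) ^ n ≤ n.factorial * (2 / c) ^ n * Real.exp (c / 2 * (1 + |y|)) := by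
    rw [div_pow]
    calc _ = (2 ^ n / c ^ n) * (c ^ n / 2 ^ n * (1 + |y|) ^ n) := by field_simp
      _ ≤ (2 ^ n / c ^ n) * (Real.exp (c / 2 * (1 + |y|)) * n.factorial) := by gcongr
      _ = _ := by ring
  calc _ ≤ n.factorial * (2 / c) ^ n * Real.exp (c / 2 * (1 + |y|)) * Real.exp (-c * |y|) := by
        gcongr
    _ = n.factorial * (2 / c) ^ n * (Real.exp (c / 2 * (1 + |y|)) * Real.exp (-c * |y|)) := by ring
    _ = n.factorial * (2 / c) ^ n * (Real.exp (c / 2) * Real.exp (-(c / 2) * |y|)) := by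
        rw [← Real.exp_add, ← Real.exp_add]; congr 2; ring
    _ = _ := by ring

lemma prod_Ioi_comp_perm {l : ℕ} {g : Fin l → Fin l → ℝ} (hg0 : ∀ i j, 0 ≤ g i j)
    (hg : ∀ i j, g i j = g j i) (σ : Equiv.Perm (Fin l)) :
    ∏ u, ∏ v ∈ Finset.Ioi u, g (σ u) (σ v) = ∏ u, ∏ v ∈ Finset.Ioi u, g u v := by
  let f : Fin l → Fin l → ℝ := fun i j => if i < j then g i j else if j < i then -g i j else 0
  have hf : ∀ i j, f i j = -f j i := by
    intro i j
    rcases lt_trichotomy i j with h | rfl | h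
    · simp [f, h, h.not_gt, hg i j]
    · simp [f]
    · simp [f, h, h.not_gt, hg i j]
  have habs : ∀ i j, i ≠ j → |f i j| = g i j := by
    intro i j hij
    rcases hij.lt_or_gt with h | h
    · simp [f, h, abs_of_nonneg (hg0 i j)]
    · simp [f, h, h.not_gt, abs_of_nonneg (hg0 i j)]
  have h := congrArg abs (σ.prod_Ioi_comp_eq_sign_mul_prod hf)
  rw [abs_mul] at h
  simp only [Finset.abs_prod] at h
  have hs : |((σ.sign : ℤ) : ℝ)| = 1 := by
    rcases Int.units_eq_one_or σ.sign with h | h <;> simp [h]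
  rw [hs, one_mul] at h
  convert h using 4 with u _ v hv u _ v hv
  · exact (habs _ _ fun e => (Finset.mem_Ioi.1 hv).ne (σ.injective e)).symm
  · exact (habs _ _ (Finset.mem_Ioi.1 hv).ne).symm

/-- Symmetrized weights whose pair factors have permutation invariant modulus are bounded by
their one-variable factors. -/
lemma norm_mul_symSum_le {l : ℕ} (A B : ℂ → ℂ → ℂ) (r : ℂ → ℂ) (S : Finset (Fin l))
    (t : Fin l → ℂ) (c : ℂ) {K : ℝ} (hK : 1 ≤ K) (hr : ∀ u, ‖r (t u)‖ ≤ K)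
    (hAB : ∀ u v, ‖A (t u) (t v) / B (t u) (t v)‖ = ‖A (t v) (t u) / B (t v) (t u)‖) :
    ‖(∏ u, ∏ v ∈ Finset.Ioi u, A (t u) (t v) / B (t u) (t v)) * c *
      SymSum (fun s => (∏ u ∈ S, r (s u)) *
        ∏ u, ∏ v ∈ Finset.Ioi u, B (s u) (s v) / A (s u) (s v)) t‖ ≤
      ‖c‖ * (l.factorial * K ^ l) := by
  rw [SymSum, Finset.mul_sum]
  refine (norm_sum_le _ _).trans ?_
  have key : ∀ σ : Equiv.Perm (Fin l),
      ‖(∏ u, ∏ v ∈ Finset.Ioi u, A (t u) (t v) / B (t u) (t v)) * c *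
        ((∏ u ∈ S, r ((t ∘ σ) u)) *
        ∏ u, ∏ v ∈ Finset.Ioi u, B ((t ∘ σ) u) ((t ∘ σ) v) / A ((t ∘ σ) u) ((t ∘ σ) v))‖ ≤
        ‖c‖ * K ^ l := by
    intro σ
    set P : ℝ := ∏ u, ∏ v ∈ Finset.Ioi u, ‖A (t u) (t v) / B (t u) (t v)‖ with hP
    have h1 : ‖∏ u, ∏ v ∈ Finset.Ioi u, A (t u) (t v) / B (t u) (t v)‖ = P := by
      simp only [norm_prod, hP]
    have h2 : ‖∏ u, ∏ v ∈ Finset.Ioi u,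
        B ((t ∘ σ) u) ((t ∘ σ) v) / A ((t ∘ σ) u) ((t ∘ σ) v)‖ = P⁻¹ := by
      rw [hP, ← prod_Ioi_comp_perm (fun _ _ => norm_nonneg _) hAB σ]
      simp only [norm_prod, ← Finset.prod_inv_distrib, ← norm_inv, inv_div, Function.comp_apply]
    have h3 : ‖∏ u ∈ S, r ((t ∘ σ) u)‖ ≤ K ^ l := by
      rw [norm_prod]
      calc _ ≤ ∏ _u ∈ S, K := Finset.prod_le_prod (fun _ _ => norm_nonneg _) fun u _ => hr (σ u)
        _ = K ^ S.card := Finset.prod_const K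
        _ ≤ K ^ l := pow_le_pow_right₀ hK (by simpa using S.card_le_univ)
    rw [norm_mul, norm_mul, norm_mul, h1, h2]
    calc _ = (P * P⁻¹) * (‖c‖ * ‖∏ u ∈ S, r ((t ∘ σ) u)‖) := by ring
      _ ≤ 1 * (‖c‖ * K ^ l) := by
          gcongr
          exact mul_inv_le_one
      _ = _ := one_mul _
  refine (Finset.sum_le_sum fun σ _ => key σ).trans_eq ?_
  rw [Finset.sum_const, Finset.card_univ, Fintype.card_perm, Fintype.card_fin, nsmul_eq_mul]
  ring

/-- At most polynomial growth, measured against `∏ (1 + |y u|)`. -/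
def PolyGrowth {l : ℕ} (f : (Fin l → ℝ) → ℂ) : Prop :=
  ∃ C, 0 ≤ C ∧ ∃ n : ℕ, ∀ y, ‖f y‖ ≤ C * (∏ u, (1 + |y u|)) ^ n

lemma one_add_abs_le_prod {l : ℕ} (y : Fin l → ℝ) (u : Fin l) :
    1 + |y u| ≤ ∏ v, (1 + |y v|) := by
  rw [← Finset.mul_prod_erase _ _ (Finset.mem_univ u)]
  have h : 1 ≤ ∏ v ∈ Finset.univ.erase u, (1 + |y v|) :=
    Finset.one_le_prod fun v _ => by have := abs_nonneg (y v); linarith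
  exact le_mul_of_one_le_right (by positivity) h

lemma one_le_prod_one_add_abs {l : ℕ} (y : Fin l → ℝ) : 1 ≤ ∏ v, (1 + |y v|) :=
  Finset.one_le_prod fun v _ => by have := abs_nonneg (y v); linarith

lemma PolyGrowth.mul {l : ℕ} {f g : (Fin l → ℝ) → ℂ} (hf : PolyGrowth f) (hg : PolyGrowth g) :
    PolyGrowth (fun y => f y * g y) := by
  obtain ⟨C, hC, n, h⟩ := hf
  obtain ⟨C', hC', n', h'⟩ := hg
  refine ⟨C * C', by positivity, n + n', fun y => ?_⟩
  rw [norm_mul]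
  calc _ ≤ (C * (∏ u, (1 + |y u|)) ^ n) * (C' * (∏ u, (1 + |y u|)) ^ n') :=
        mul_le_mul (h y) (h' y) (norm_nonneg _) ((norm_nonneg _).trans (h y))
    _ = _ := by ring

lemma PolyGrowth.prod {l : ℕ} {ι : Type*} (S : Finset ι) {f : ι → (Fin l → ℝ) → ℂ}
    (hf : ∀ i ∈ S, PolyGrowth (f i)) : PolyGrowth (fun y => ∏ i ∈ S, f i y) := by
  classical
  induction S using Finset.induction_on with
  | empty => exact ⟨1, zero_le_one, 0, fun y => by simp⟩
  | insert i S hi ih =>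
    simp only [Finset.prod_insert hi]
    exact (hf i (Finset.mem_insert_self i S)).mul
      (ih fun j hj => hf j (Finset.mem_insert_of_mem hj))

lemma PolyGrowth.Gamma_div_Gamma {l : ℕ} {x x' : ℝ} (hx : 0 < x) (hx' : x' < 1) (s A : ℝ)
    (hA : 0 ≤ A) {w w' : (Fin l → ℝ) → ℂ} (hw : ∀ y, (w y).re = x) (hw' : ∀ y, (w' y).re = x')
    (hs : ∀ y, (w' y).im = (w y).im + s) (hwA : ∀ y, |(w y).im| ≤ A * ∏ u, (1 + |y u|)) :
    PolyGrowth (fun y => Complex.Gamma (w y) / Complex.Gamma (w' y)) := by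
  obtain ⟨C, hC, n, h⟩ := Complex.norm_Gamma_div_Gamma_le hx hx' s
  refine ⟨C * (1 + A) ^ n, by positivity, n, fun y => (h _ _ (hw y) (hw' y) (hs y)).trans ?_⟩
  have h1 := one_le_prod_one_add_abs y
  calc _ ≤ C * ((1 + A) * ∏ u, (1 + |y u|)) ^ n := by
        gcongr
        linarith [hwA y]
    _ = _ := by rw [mul_pow]; ring

lemma Complex.exists_norm_div_le {ρ : ℝ} (hρ : ρ ≠ 0) (c : ℂ) :
    ∃ K, 1 ≤ K ∧ ∀ w : ℂ, (w + c).re = ρ → ‖w / (w + c)‖ ≤ K := by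
  refine ⟨1 + ‖c‖ / |ρ|, by simp; positivity, fun w hw => ?_⟩
  have h1 : |ρ| ≤ ‖w + c‖ := hw ▸ Complex.abs_re_le_norm (w + c)
  have h2 : 0 < ‖w + c‖ := (abs_pos.2 hρ).trans_le h1
  have h3 : w / (w + c) = 1 - c / (w + c) := by
    have := norm_pos_iff.1 h2
    field_simp
    ring
  rw [h3]
  refine (norm_sub_le _ _).trans ?_
  rw [norm_one, norm_div]
  gcongr

lemma polyGrowth_qMaster_Gamma {κ ε : ℝ} (hκ : 0 < κ) (hε : 0 < ε) {l : ℕ} {z m₁ m₂ : ℂ}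
    (hz : z.re = 0) (h₁ : ε + m₁.re < 0) (h₂ : ε + m₂.re < 0) :
    PolyGrowth (fun y : Fin l → ℝ =>
      (∏ u, (Complex.Gamma (((ε : ℂ) + Complex.I * (y u)) / κ) *
          Complex.Gamma ((((ε : ℂ) + Complex.I * (y u)) - z) / κ)) /
        (Complex.Gamma ((((ε : ℂ) + Complex.I * (y u)) + m₁) / κ) *
          Complex.Gamma ((((ε : ℂ) + Complex.I * (y u)) - z + m₂) / κ))) *
      ∏ u, ∏ v ∈ Finset.Ioi u,
        Complex.Gamma ((((ε : ℂ) + Complex.I * (y u)) - ((ε : ℂ) + Complex.I * (y v)) + 1) / κ) /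
        Complex.Gamma ((((ε : ℂ) + Complex.I * (y u)) - ((ε : ℂ) + Complex.I * (y v)) - 1) / κ)) := by
  refine PolyGrowth.mul ?_ ?_
  · refine PolyGrowth.prod _ fun u _ => ?_
    simp only [mul_div_mul_comm]
    refine PolyGrowth.mul ?_ ?_
    · refine PolyGrowth.Gamma_div_Gamma (x := ε / κ) (x' := (ε + m₁.re) / κ) (by positivity)
        ((div_neg_of_neg_of_pos h₁ hκ).trans one_pos) (m₁.im / κ) (1 / κ) (by positivity)
        (fun y => ?_) (fun y => ?_) (fun y => ?_) (fun y => ?_)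
      · simp [Complex.div_ofReal_re]
      · simp [Complex.div_ofReal_re]
      · simp [Complex.div_ofReal_im]; ring
      · have := one_add_abs_le_prod y u
        simp only [Complex.div_ofReal_im, Complex.add_im, Complex.ofReal_im, Complex.I_mul_im,
          Complex.ofReal_re, zero_add, abs_div, abs_of_pos hκ]
        rw [div_mul_eq_mul_div, one_mul]
        gcongr
        linarith
    · refine PolyGrowth.Gamma_div_Gamma (x := ε / κ) (x' := (ε + m₂.re) / κ) (by positivity)
        ((div_neg_of_neg_of_pos h₂ hκ).trans one_pos) (m₂.im / κ) ((1 + |z.im|) / κ)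
        (by positivity) (fun y => ?_) (fun y => ?_) (fun y => ?_) (fun y => ?_)
      · simp [Complex.div_ofReal_re, hz]
      · simp [Complex.div_ofReal_re, hz]
      · simp [Complex.div_ofReal_im]; ring
      · have h := one_add_abs_le_prod y u
        simp only [Complex.div_ofReal_im, Complex.add_im, Complex.ofReal_im, Complex.I_mul_im,
          Complex.ofReal_re, zero_add, abs_div, abs_of_pos hκ, Complex.sub_im]
        rw [div_mul_eq_mul_div]
        gcongr
        have h3 := abs_sub (y u) z.im
        nlinarith [abs_nonneg z.im, abs_nonneg (y u)]
  · refine PolyGrowth.prod _ fun u _ => PolyGrowth.prod _ fun v _ => ?_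
    refine PolyGrowth.Gamma_div_Gamma (x := 1 / κ) (x' := -1 / κ) (by positivity)
      ((div_neg_of_neg_of_pos (by norm_num) hκ).trans one_pos) 0 (2 / κ)
      (by positivity) (fun y => ?_) (fun y => ?_) (fun y => ?_) (fun y => ?_)
    · simp [Complex.div_ofReal_re]
    · simp [Complex.div_ofReal_re]
    · simp [Complex.div_ofReal_im]
    · have h := one_add_abs_le_prod y u
      have h' := one_add_abs_le_prod y v
      simp only [Complex.div_ofReal_im, Complex.add_im, Complex.ofReal_im, Complex.I_mul_im,
        Complex.ofReal_re, zero_add, abs_div, abs_of_pos hκ, Complex.sub_im, Complex.one_im,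
        add_zero]
      rw [div_mul_eq_mul_div]
      gcongr
      have h3 := abs_sub (y u) (y v)
      linarith

lemma exists_norm_ratWeight_le {ε : ℝ} {l : ℕ} (a : ℕ) {z m₁ m₂ : ℂ}
    (hz : z.re = 0) (h₁ : ε + m₁.re ≠ 0) (h₂ : ε + m₂.re ≠ 0) :
    ∃ C, 0 ≤ C ∧ ∀ y : Fin l → ℝ,
      ‖ratWeight a (fun u => (ε : ℂ) + Complex.I * (y u)) z m₁ m₂‖ ≤ C := by
  obtain ⟨K, hK, hr⟩ := Complex.exists_norm_div_le h₂ (-z + m₂)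
  refine ⟨|ε + m₁.re|⁻¹ ^ l * (l.factorial * K ^ l), by positivity, fun y => ?_⟩
  refine (norm_mul_symSum_le (fun p q => p - q) (fun p q => p - q - 1)
    (fun s => s / (s - z + m₂)) _ _ _ hK (fun u => ?_) (fun u v => ?_)).trans ?_
  · have h := hr ((ε : ℂ) + Complex.I * (y u)) (by simp [hz])
    rwa [← add_assoc, ← sub_eq_add_neg] at h
  · rw [← Complex.norm_conj]
    congr 1
    simp
    ring
  · gcongr
    rw [norm_prod]
    calc _ ≤ ∏ _u : Fin l, |ε + m₁.re|⁻¹ := by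
          refine Finset.prod_le_prod (fun _ _ => norm_nonneg _) fun u _ => ?_
          rw [norm_inv]
          refine inv_anti₀ (abs_pos.2 h₁) ?_
          simpa using Complex.abs_re_le_norm ((ε : ℂ) + Complex.I * (y u) + m₁)
      _ = _ := by simp

lemma exists_norm_trigWeight_le {κ ε : ℝ} (hκ : 0 < κ) {l : ℕ} (b : ℕ) {z m₁ m₂ : ℂ}
    (hz : z.re = 0) (h₂ : ∀ n : ℤ, ε + m₂.re ≠ κ * n) :
    ∃ C, 0 ≤ C ∧ ∀ y : Fin l → ℝ,
      ‖trigWeight κ b (fun u => (ε : ℂ) + Complex.I * (y u)) z m₁ m₂‖ ≤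
        (∏ u, ‖Complex.exp (-(π : ℂ) * Complex.I * ((ε : ℂ) + Complex.I * (y u)) / κ) /
          Complex.sin ((π : ℂ) * (((ε : ℂ) + Complex.I * (y u)) + m₁) / κ)‖) * C := by
  obtain ⟨c, hc, hsin⟩ := Complex.exp_le_const_mul_norm_sin (x := (ε + m₂.re) / κ) fun n hn =>
    h₂ n (by rw [← hn]; field_simp)
  set E : ℝ := ‖Complex.exp ((π : ℂ) * Complex.I * z / κ)‖ with hE
  set K : ℝ := max 1 (E * Real.exp (π * |(m₂.im - z.im) / κ|) / c)
  have hK : 1 ≤ K := le_max_left _ _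
  refine ⟨l.factorial * K ^ l, by positivity, fun y => ?_⟩
  refine (norm_mul_symSum_le (fun p q => Complex.sin ((π : ℂ) * (p - q) / κ))
    (fun p q => Complex.sin ((π : ℂ) * (p - q - 1) / κ))
    (fun s => Complex.exp ((π : ℂ) * Complex.I * z / κ) * Complex.sin ((π : ℂ) * s / κ) /
          Complex.sin ((π : ℂ) * (s - z + m₂) / κ)) _ _ _ hK (fun u => ?_) (fun u v => ?_)).trans ?_
  · refine le_trans ?_ (le_max_right _ _)
    have h1 := Complex.norm_sin_pi_mul_le (((ε : ℂ) + Complex.I * (y u)) / κ)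
    have h2 := hsin ((((ε : ℂ) + Complex.I * (y u)) - z + m₂) / κ)
      (by simp [Complex.div_ofReal_re, hz])
    have him1 : (((ε : ℂ) + Complex.I * (y u)) / κ).im = y u / κ := by
      simp [Complex.div_ofReal_im]
    have him2 : ((((ε : ℂ) + Complex.I * (y u)) - z + m₂) / κ).im
        = y u / κ + (m₂.im - z.im) / κ := by
      simp [Complex.div_ofReal_im]; ring
    rw [him1] at h1
    rw [him2] at h2
    rw [mul_div_assoc (π : ℂ), mul_div_assoc (π : ℂ) _ (κ : ℂ), norm_div, norm_mul, ← hE]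
    have h3 : |y u / κ| ≤ |y u / κ + (m₂.im - z.im) / κ| + |(m₂.im - z.im) / κ| := by
      have := abs_sub (y u / κ + (m₂.im - z.im) / κ) ((m₂.im - z.im) / κ)
      rwa [add_sub_cancel_right] at this
    rw [div_le_div_iff₀ (lt_of_lt_of_le (by positivity) h2) hc]
    calc _ ≤ E * Real.exp (π * (|y u / κ + (m₂.im - z.im) / κ| + |(m₂.im - z.im) / κ|)) * c := by
          gcongr
          exact h1.trans (Real.exp_le_exp.2 (by gcongr))
      _ = E * Real.exp (π * |(m₂.im - z.im) / κ|) *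
          (c * Real.exp (π * |y u / κ + (m₂.im - z.im) / κ|)) := by
          rw [mul_add, Real.exp_add]; ring
      _ ≤ _ := by gcongr
  · rw [← Complex.norm_conj]
    simp only [map_div₀, ← Complex.sin_conj, map_mul, map_sub, map_add, Complex.conj_ofReal,
      Complex.conj_I, map_one]
    congr 4 <;> ring
  · rw [norm_prod]

lemma exists_norm_exp_mul_exp_div_sin_le {κ ε : ℝ} (hκ : 0 < κ) {m₁ μ : ℂ}
    (h₁ : ∀ n : ℤ, ε + m₁.re ≠ κ * n) (hμ0 : 0 < μ.im) (hμ : μ.im < 2 * π) :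
    ∃ C, 0 ≤ C ∧ ∃ δ > 0, ∀ y : ℝ,
      ‖Complex.exp (μ * ((ε : ℂ) + Complex.I * y) / κ)‖ *
        ‖Complex.exp (-(π : ℂ) * Complex.I * ((ε : ℂ) + Complex.I * y) / κ) /
          Complex.sin ((π : ℂ) * (((ε : ℂ) + Complex.I * y) + m₁) / κ)‖ ≤
        C * Real.exp (-δ * |y|) := by
  obtain ⟨c, hc, hsin⟩ := Complex.exp_le_const_mul_norm_sin (x := (ε + m₁.re) / κ) fun n hn =>
    h₁ n (by rw [← hn]; field_simp)
  set D : ℝ := μ.re * ε / κ + π * |m₁.im / κ| with hD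
  refine ⟨Real.exp D / c, by positivity, min μ.im (2 * π - μ.im) / κ,
    div_pos (lt_min hμ0 (by linarith)) hκ, fun y => ?_⟩
  have h2 := hsin ((((ε : ℂ) + Complex.I * y) + m₁) / κ) (by simp [Complex.div_ofReal_re])
  have him2 : ((((ε : ℂ) + Complex.I * y) + m₁) / κ).im = y / κ + m₁.im / κ := by
    simp [Complex.div_ofReal_im]; ring
  rw [him2] at h2
  have hre1 : (μ * ((ε : ℂ) + Complex.I * y) / κ).re = (μ.re * ε - μ.im * y) / κ := by
    simp [Complex.div_ofReal_re]
  have hre2 : (-(π : ℂ) * Complex.I * ((ε : ℂ) + Complex.I * y) / κ).re = π * y / κ := by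
    simp [Complex.div_ofReal_re]
  rw [mul_div_assoc (π : ℂ), norm_div, Complex.norm_exp, Complex.norm_exp, hre1, hre2,
    ← mul_div_assoc, ← Real.exp_add, div_mul_eq_mul_div, ← Real.exp_add]
  rw [div_le_div_iff₀ (lt_of_lt_of_le (by positivity) h2) hc]
  have key : (μ.re * ε - μ.im * y) / κ + π * y / κ ≤
      D + -(min μ.im (2 * π - μ.im) / κ) * |y| + π * |y / κ + m₁.im / κ| := by
    have h3 : |y / κ| ≤ |y / κ + m₁.im / κ| + |m₁.im / κ| := by
      have := abs_sub (y / κ + m₁.im / κ) (m₁.im / κ)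
      rwa [add_sub_cancel_right] at this
    have h4 : (-μ.im * y + π * y) ≤ -(min μ.im (2 * π - μ.im)) * |y| + π * |y| := by
      rcases le_total 0 y with hy | hy
      · rw [abs_of_nonneg hy]
        nlinarith [min_le_left μ.im (2 * π - μ.im)]
      · rw [abs_of_nonpos hy]
        nlinarith [min_le_right μ.im (2 * π - μ.im)]
    have h5 := div_le_div_of_nonneg_right h4 hκ.le
    have h6 := mul_le_mul_of_nonneg_left h3 Real.pi_pos.le
    rw [abs_div, abs_of_pos hκ] at h6
    calc _ = μ.re * ε / κ + (-μ.im * y + π * y) / κ := by ring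
      _ ≤ μ.re * ε / κ + (-(min μ.im (2 * π - μ.im)) * |y| + π * |y|) / κ := by gcongr
      _ = μ.re * ε / κ + -(min μ.im (2 * π - μ.im) / κ) * |y| + π * (|y| / κ) := by ring
      _ ≤ _ := by rw [hD]; linarith
  calc _ ≤ Real.exp (D + -(min μ.im (2 * π - μ.im) / κ) * |y| + π * |y / κ + m₁.im / κ|) * c := by
        gcongr
    _ = Real.exp (D + -(min μ.im (2 * π - μ.im) / κ) * |y|) *
        (c * Real.exp (π * |y / κ + m₁.im / κ|)) := by rw [Real.exp_add]; ring
    _ ≤ _ := by gcongr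

lemma measurable_integrand (κ ε : ℝ) {l : ℕ} (a b : ℕ) (z μ m₁ m₂ : ℂ) :
    Measurable (fun y : Fin l → ℝ =>
      qMaster (κ : ℂ) (fun u => (ε : ℂ) + Complex.I * (y u)) z μ m₁ m₂ *
        ratWeight a (fun u => (ε : ℂ) + Complex.I * (y u)) z m₁ m₂ *
        trigWeight (κ : ℂ) b (fun u => (ε : ℂ) + Complex.I * (y u)) z m₁ m₂) := by
  have hG := measurable_complexGamma
  have ht : ∀ u : Fin l, Measurable fun y : Fin l → ℝ => (ε : ℂ) + Complex.I * (y u) :=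
    fun u => by fun_prop
  simp only [qMaster, ratWeight, trigWeight, SymSum, Function.comp_apply]
  refine ((?_ : Measurable _).mul ?_).mul ?_
  · refine ((?_ : Measurable _).mul ?_).mul ?_
    · fun_prop
    · exact Finset.measurable_prod _ fun u _ => by fun_prop
    · exact Finset.measurable_prod _ fun u _ => Finset.measurable_prod _ fun v _ => by fun_prop
  · fun_prop
  · fun_prop

lemma integrable_integrand {κ ε : ℝ} (hκ : 0 < κ) {l : ℕ} (a b : ℕ) {z μ m₁ m₂ : ℂ}
    (hz : z.re = 0) (hμ0 : 0 < μ.im) (hμ : μ.im < 2 * π) (hε : 0 < ε)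
    (hm₁ : ε + m₁.re < 0) (hm₂ : ε + m₂.re < 0)
    (h₁ : ∀ n : ℤ, ε + m₁.re ≠ κ * n) (h₂ : ∀ n : ℤ, ε + m₂.re ≠ κ * n) :
    Integrable (fun y : Fin l → ℝ =>
      qMaster (κ : ℂ) (fun u => (ε : ℂ) + Complex.I * (y u)) z μ m₁ m₂ *
        ratWeight a (fun u => (ε : ℂ) + Complex.I * (y u)) z m₁ m₂ *
        trigWeight (κ : ℂ) b (fun u => (ε : ℂ) + Complex.I * (y u)) z m₁ m₂) := by
  obtain ⟨CΦ, hCΦ, n, hΦ⟩ := polyGrowth_qMaster_Gamma (l := l) hκ hε hz hm₁ hm₂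
  obtain ⟨Cw, hCw, hw⟩ := exists_norm_ratWeight_le (l := l) a hz hm₁.ne hm₂.ne
  obtain ⟨CW, hCW, hW⟩ := exists_norm_trigWeight_le (l := l) (m₁ := m₁) hκ b hz h₂
  obtain ⟨C, hC, δ, hδ, hE⟩ := exists_norm_exp_mul_exp_div_sin_le hκ h₁ hμ0 hμ
  refine Integrable.mono' ((Integrable.fintype_prod (μ := fun _ : Fin l => volume) fun _ =>
      integrable_one_add_abs_pow_mul_exp hδ n).const_mul (CΦ * Cw * CW * C ^ l))
    (measurable_integrand κ ε a b z μ m₁ m₂).aestronglyMeasurable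
    (Filter.Eventually.of_forall fun y => ?_)
  have hexp : ‖Complex.exp (μ * (∑ u, ((ε : ℂ) + Complex.I * (y u))) / κ)‖ =
      ∏ u, ‖Complex.exp (μ * ((ε : ℂ) + Complex.I * (y u)) / κ)‖ := by
    rw [← norm_prod, ← Complex.exp_sum, Finset.mul_sum, Finset.sum_div]
  have hdecay := Finset.prod_le_prod (s := Finset.univ)
    (fun u _ => mul_nonneg (norm_nonneg _) (norm_nonneg _)) fun u _ => hE (y u)
  rw [Finset.prod_mul_distrib, Finset.prod_mul_distrib, Finset.prod_const, Finset.card_univ,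
    Fintype.card_fin] at hdecay
  set t : Fin l → ℂ := fun u => (ε : ℂ) + Complex.I * (y u) with ht
  set P : ℝ := ∏ u, (1 + |y u|) with hP
  set X : ℝ := ∏ u, ‖Complex.exp (μ * ((ε : ℂ) + Complex.I * (y u)) / κ)‖ with hX
  have hX0 : 0 ≤ X := Finset.prod_nonneg fun _ _ => norm_nonneg _
  have hP1 : 1 ≤ P := one_le_prod_one_add_abs y
  have hΦ' : ‖qMaster (κ : ℂ) t z μ m₁ m₂‖ ≤ X * (CΦ * P ^ n) := by
    rw [qMaster, mul_assoc (Complex.exp _), norm_mul, hexp]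
    exact mul_le_mul_of_nonneg_left (hΦ y) hX0
  have hw' := hw y
  have hW' := hW y
  rw [← ht] at hw' hW'
  rw [Finset.prod_mul_distrib, Finset.prod_pow, ← hP, norm_mul, norm_mul]
  generalize ‖qMaster (κ : ℂ) t z μ m₁ m₂‖ = A₁ at *
  have hA₂ := norm_nonneg (ratWeight a t z m₁ m₂)
  have hA₃ := norm_nonneg (trigWeight (κ : ℂ) b t z m₁ m₂)
  generalize ‖ratWeight a t z m₁ m₂‖ = A₂ at *
  generalize ‖trigWeight (κ : ℂ) b t z m₁ m₂‖ = A₃ at *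
  generalize (∏ u, ‖Complex.exp (-(π : ℂ) * Complex.I * ((ε : ℂ) + Complex.I * (y u)) / κ) /
    Complex.sin ((π : ℂ) * (((ε : ℂ) + Complex.I * (y u)) + m₁) / κ)‖) = Y at *
  generalize (∏ u, Real.exp (-δ * |y u|)) = Z at *
  clear_value X P
  clear hΦ hw hW hE hexp
  have hP0 : 0 ≤ P := zero_le_one.trans hP1
  calc A₁ * A₂ * A₃ ≤ (X * (CΦ * P ^ n)) * Cw * (Y * CW) := by gcongr
    _ = (CΦ * Cw * CW * P ^ n) * (X * Y) := by ring
    _ ≤ (CΦ * Cw * CW * P ^ n) * (C ^ l * Z) := by gcongr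
    _ = _ := by ring

lemma Complex.sin_pi_mul_div_ne_zero {κ : ℝ} (hκ : 0 < κ) {w : ℂ}
    (hw : ∀ n : ℤ, w.re ≠ κ * n) : Complex.sin ((π : ℂ) * w / κ) ≠ 0 := by
  rw [Complex.sin_ne_zero_iff]
  intro n h
  have hπ : (π : ℂ) ≠ 0 := Complex.ofReal_ne_zero.2 Real.pi_ne_zero
  have hκ' : (κ : ℂ) ≠ 0 := Complex.ofReal_ne_zero.2 hκ.ne'
  have h' : w = ((κ * n : ℝ) : ℂ) := by
    field_simp at h
    push_cast
    linear_combination h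
  exact hw n (by rw [h', Complex.ofReal_re])

/-- On the contour `t_u = ε + i y_u`, the integrand
`Φ_{l}(t,z,μ;m₁,m₂) w_{l−a,a}(t,z;m₁,m₂) W_{l−b,b}(t,z;m₁,m₂)` of the Barnes type
q-hypergeometric integral `I_{a,b}` is well defined (its denominators are nonzero and
no Gamma factor sits at a pole) and is absolutely integrable over `ℝ^l`. -/
theorem qHypergeometric_integrand_welldefined_and_integrable
    (κ : ℝ) (hκ : 0 < κ) (hκZ : ∀ n : ℤ, 1 / κ ≠ (n : ℝ))
    (l : ℕ) (hl : 0 < l) (a b : ℕ) (ha : a ≤ l) (hb : b ≤ l)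
    (m₁ m₂ z μ : ℂ) (hm₁ : m₁.re < 0) (hm₂ : m₂.re < 0) (hz : z.re = 0)
    (hμim0 : 0 < μ.im) (hμim : μ.im < 2 * π)
    (ε : ℝ) (hε0 : 0 < ε) (hε : ε < min (-m₁.re) (-m₂.re))
    (hεm₁ : ∀ n : ℤ, ε + m₁.re ≠ κ * n) (hεm₂ : ∀ n : ℤ, ε + m₂.re ≠ κ * n) :
    (∀ y : Fin l → ℝ,
      (∀ u : Fin l,
        ((ε : ℂ) + Complex.I * (y u)) + m₁ ≠ 0 ∧
        ((ε : ℂ) + Complex.I * (y u)) - z + m₂ ≠ 0 ∧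
        Complex.sin ((π : ℂ) * (((ε : ℂ) + Complex.I * (y u)) + m₁) / (κ : ℂ)) ≠ 0 ∧
        Complex.sin ((π : ℂ) * (((ε : ℂ) + Complex.I * (y u)) - z + m₂) / (κ : ℂ)) ≠ 0 ∧
        Complex.Gamma (((ε : ℂ) + Complex.I * (y u)) / (κ : ℂ)) ≠ 0 ∧
        Complex.Gamma ((((ε : ℂ) + Complex.I * (y u)) - z) / (κ : ℂ)) ≠ 0) ∧
      (∀ u v : Fin l, u ≠ v →
        (Complex.I * (y u) - Complex.I * (y v)) - 1 ≠ 0 ∧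
        Complex.sin ((π : ℂ) * ((Complex.I * (y u) - Complex.I * (y v)) - 1) / (κ : ℂ)) ≠ 0 ∧
        Complex.Gamma (((Complex.I * (y u) - Complex.I * (y v)) + 1) / (κ : ℂ)) ≠ 0)) ∧
    Integrable (fun y : Fin l → ℝ =>
      qMaster (κ : ℂ) (fun u => (ε : ℂ) + Complex.I * (y u)) z μ m₁ m₂ *
        ratWeight a (fun u => (ε : ℂ) + Complex.I * (y u)) z m₁ m₂ *
        trigWeight (κ : ℂ) b (fun u => (ε : ℂ) + Complex.I * (y u)) z m₁ m₂) := by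
  have hε₁ : ε + m₁.re < 0 := by linarith [hε.trans_le (min_le_left _ _)]
  have hε₂ : ε + m₂.re < 0 := by linarith [hε.trans_le (min_le_right _ _)]
  refine ⟨fun y => ⟨fun u => ⟨?_, ?_, ?_, ?_, ?_, ?_⟩, fun u v _ => ⟨?_, ?_, ?_⟩⟩,
    integrable_integrand hκ a b hz hμim0 hμim hε0 hε₁ hε₂ hεm₁ hεm₂⟩
  · exact fun h => hε₁.ne (by simpa using congrArg Complex.re h)
  · exact fun h => hε₂.ne (by simpa [hz] using congrArg Complex.re h)
  · exact Complex.sin_pi_mul_div_ne_zero hκ fun n => by simpa using hεm₁ n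
  · exact Complex.sin_pi_mul_div_ne_zero hκ fun n => by simpa [hz] using hεm₂ n
  · exact Complex.Gamma_ne_zero_of_re_pos (by simpa [Complex.div_ofReal_re] using div_pos hε0 hκ)
  · exact Complex.Gamma_ne_zero_of_re_pos
      (by simpa [Complex.div_ofReal_re, hz] using div_pos hε0 hκ)
  · exact fun h => by simpa using congrArg Complex.re h
  · refine Complex.sin_pi_mul_div_ne_zero hκ fun n hn => hκZ (-n) ?_
    have hn' : -1 = κ * (n : ℝ) := by simpa using hn
    rw [div_eq_iff hκ.ne']
    push_cast
    linarith
  · exact Complex.Gamma_ne_zero_of_re_pos (by simpa [Complex.div_ofReal_re] using hκ)
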